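/- Let n ≥ 3 and let A₁, …, A_n ∈ SL(2,ℂ) be such that tr ρ(w_I) is real for every nonempty subset I ⊆ {1,…,n}. Suppose the tuple (A₁,…,A_n) is elementwise-periodic, i.e. for every automorphism α of F_n the set {χ(αᵏ) : k ∈ ℕ} is finite. Then the full orbit set {χ(α) : α an automorphism of F_n} is finite, and at least one of the following holds: (i) there exists t = (t₁,…,t_n) ∈ ℝⁿ such that tr ρ(w_I)/2 = cos(2π Σ_{i∈I} t_i) for every nonempty I ⊆ {1,…,n}; (ii) the subgroup of SL(2,ℂ) generated by A₁, …, A_n is finite. -/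

import Mathlib

open Matrix Real

noncomputable section

abbrev SL2C := Matrix.SpecialLinearGroup (Fin 2) ℂ

/-- The representation `F_n → SL(2,ℂ)` sending `aᵢ ↦ Aᵢ`. -/
def rho (n : ℕ) (A : Fin n → SL2C) : FreeGroup (Fin n) →* SL2C := FreeGroup.lift A

/-- For a subset `I = {i₁ < i₂ < … < i_k}` of `{1,…,n}`, the word
`w_I = a_{i₁} a_{i₂} ⋯ a_{i_k}`. -/
def wI (n : ℕ) (I : Finset (Fin n)) : FreeGroup (Fin n) :=
  ((I.sort (· ≤ ·)).map FreeGroup.of).prod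

/-- `χ(α) = (tr ρ(α(w_I))/2)_I`, indexed by the nonempty subsets of `{1,…,n}`. -/
def chi (n : ℕ) (A : Fin n → SL2C) (α : MulAut (FreeGroup (Fin n))) :
    {I : Finset (Fin n) // I.Nonempty} → ℂ :=
  fun I => Matrix.trace ((rho n A (α (wI n I.1)) : Matrix (Fin 2) (Fin 2) ℂ)) / 2

/-- `(A₁,…,A_n)` is elementwise-periodic. -/
def ElemPeriodic (n : ℕ) (A : Fin n → SL2C) : Prop :=
  ∀ α : MulAut (FreeGroup (Fin n)), (Set.range fun k : ℕ => chi n A (α ^ k)).Finite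

theorem ext_equiv {K L₁ L₂ : Type} [Field K] [Field L₁] [Field L₂] [IsAlgClosed L₁]
    [IsAlgClosed L₂] [Algebra K L₁] [Algebra K L₂] (hK : Cardinal.mk K ≤ Cardinal.aleph0)
    (h1 : Cardinal.aleph0 < Cardinal.mk L₁) (h12 : Cardinal.mk L₁ = Cardinal.mk L₂) :
    ∃ σ : L₁ ≃+* L₂, ∀ x : K, σ (algebraMap K L₁ x) = algebraMap K L₂ x := by
  obtain ⟨s, hs⟩ := exists_isTranscendenceBasis K L₁
  obtain ⟨t, ht⟩ := exists_isTranscendenceBasis K L₂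
  have hc : Cardinal.mk s = Cardinal.mk t := by
    rw [← IsAlgClosed.cardinal_eq_cardinal_transcendence_basis_of_aleph0_lt' _ hs hK h1,
      ← IsAlgClosed.cardinal_eq_cardinal_transcendence_basis_of_aleph0_lt' _ ht hK (h12 ▸ h1), h12]
  obtain ⟨e⟩ := Cardinal.eq.1 hc
  let := IsAlgClosed.isAlgClosure_of_transcendence_basis _ hs
  let := IsAlgClosed.isAlgClosure_of_transcendence_basis _ ht
  let e' : Algebra.adjoin K (Set.range (Subtype.val : s → L₁)) ≃ₐ[K]
      Algebra.adjoin K (Set.range (Subtype.val : t → L₂)) :=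
    (hs.1.aevalEquiv.symm.trans (MvPolynomial.renameEquiv K e)).trans ht.1.aevalEquiv
  refine ⟨IsAlgClosure.equivOfEquiv L₁ L₂ e'.toRingEquiv, fun x => ?_⟩
  rw [IsScalarTower.algebraMap_apply K (Algebra.adjoin K (Set.range (Subtype.val : s → L₁))) L₁,
    IsAlgClosure.equivOfEquiv_algebraMap]
  rw [IsScalarTower.algebraMap_apply K (Algebra.adjoin K (Set.range (Subtype.val : t → L₂))) L₂]
  congr 1
  exact e'.commutes x

theorem fin_of_conj (T : Set ℂ) (hT : T.Finite) (hTi : ∀ t ∈ T, IsIntegral ℤ t) (S : Set ℂ)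
    (hS : ∀ s ∈ S, s ∈ Subring.closure T)
    (hb : ∀ s ∈ S, ∀ σ : ℂ ≃+* ℂ, ‖σ s‖ ≤ 2) : S.Finite := by
  let K := IntermediateField.adjoin ℚ T
  have : Finite T := hT
  have : FiniteDimensional ℚ K :=
    IntermediateField.finiteDimensional_adjoin (fun x hx => (hTi x hx).tower_top)
  have : NumberField K := ⟨⟩
  have hsub : ∀ s ∈ Subring.closure T, s ∈ K ∧ IsIntegral ℤ s := by
    intro s hs
    refine ⟨?_, ?_⟩
    · have : Subring.closure T ≤ K.toSubfield.toSubring :=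
        Subring.closure_le.2 (fun x hx => IntermediateField.subset_adjoin ℚ T hx)
      exact this hs
    · have : Subring.closure T ≤ (integralClosure ℤ ℂ).toSubring :=
        Subring.closure_le.2 (fun x hx => hTi x hx)
      exact this hs
  have hf := NumberField.Embeddings.finite_of_norm_le K ℂ 2
  refine (hf.image (algebraMap K ℂ)).subset fun s hs => ?_
  obtain ⟨hsK, hsi⟩ := hsub s (hS s hs)
  refine ⟨⟨s, hsK⟩, ⟨?_, fun φ => ?_⟩, rfl⟩
  · exact (isIntegral_algebraMap_iff (algebraMap K ℂ).injective).1 hsi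
  · have hKc : Cardinal.mk K ≤ Cardinal.aleph0 := by
      have := Algebra.IsAlgebraic.cardinalMk_le_max ℚ K
      simpa using this
    obtain ⟨σ, hσ⟩ := @ext_equiv K ℂ ℂ _ _ _ _ _ inferInstance φ.toAlgebra hKc
      (by simpa using Cardinal.aleph0_lt_continuum) rfl
    have := hσ ⟨s, hsK⟩
    have h2 : σ s = φ ⟨s, hsK⟩ := this
    rw [← h2]
    exact hb s hs σ


/-- coefficient matrix of a group element -/
def mx (X : SL2C) : Matrix (Fin 2) (Fin 2) ℂ := (X : Matrix (Fin 2) (Fin 2) ℂ)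
/-- trace -/
def tr (X : SL2C) : ℂ := Matrix.trace (mx X)

theorem mx_mul (X Y : SL2C) : mx (X * Y) = mx X * mx Y := rfl
theorem mx_one : mx 1 = 1 := rfl
theorem mx_inj {X Y : SL2C} (h : mx X = mx Y) : X = Y := Subtype.ext h

theorem tr_eq (X : SL2C) : tr X = mx X 0 0 + mx X 1 1 := by simp [tr, Matrix.trace_fin_two]

theorem det_eq (X : SL2C) : mx X 0 0 * mx X 1 1 - mx X 0 1 * mx X 1 0 = 1 := by
  have := X.2
  rwa [Matrix.det_fin_two] at this

theorem tr_mul_comm (X Y : SL2C) : tr (X * Y) = tr (Y * X) := by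
  simp only [tr, mx_mul]; exact Matrix.trace_mul_comm _ _

theorem mx_inv (X : SL2C) : mx X⁻¹ = tr X • (1 : Matrix (Fin 2) (Fin 2) ℂ) - mx X := by
  rw [tr_eq, mx, mx, SpecialLinearGroup.SL2_inv_expl]
  ext i j; fin_cases i <;> fin_cases j <;> simp

theorem mx_sq (X : SL2C) : mx X * mx X = tr X • mx X - 1 := by
  have := det_eq X
  rw [tr_eq]
  ext i j; fin_cases i <;> fin_cases j <;> simp [Matrix.mul_apply, Fin.sum_univ_two]
  · linear_combination (-1 : ℂ) * this
  · ring
  · ring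
  · linear_combination (-1 : ℂ) * this

theorem mx_anti (X Y : SL2C) : mx X * mx Y = - (mx Y * mx X) + tr X • mx Y + tr Y • mx X
    + (tr (Y * X) - tr X * tr Y) • (1 : Matrix (Fin 2) (Fin 2) ℂ) := by
  simp only [tr_eq, mx_mul]
  ext i j; fin_cases i <;> fin_cases j <;> simp [Matrix.mul_apply, Fin.sum_univ_two] <;> ring

section horo
variable {n : ℕ}

/-- word of a list -/
def wl (l : List (Fin n)) (A : Fin n → SL2C) : SL2C := (l.map A).prod

/-- ring of trace functions -/
def SS (n : ℕ) : Subring ((Fin n → SL2C) → ℂ) :=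
  Subring.closure {f | ∃ l : List (Fin n), l.Pairwise (· < ·) ∧ f = fun A => tr (wl l A)}

theorem mem_SS (l : List (Fin n)) (hl : l.Pairwise (· < ·)) : (fun A => tr (wl l A)) ∈ SS n :=
  Subring.subset_closure ⟨l, hl, rfl⟩

/-- span of words -/
inductive InM (p : Fin n → Prop) : ((Fin n → SL2C) → Matrix (Fin 2) (Fin 2) ℂ) → Prop
  | base (s : (Fin n → SL2C) → ℂ) (hs : s ∈ SS n) (l : List (Fin n)) (hl : l.Pairwise (· < ·))
      (hp : ∀ x ∈ l, p x) : InM p (fun A => s A • mx (wl l A))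
  | add (f g) : InM p f → InM p g → InM p (fun A => f A + g A)

theorem InM.mono {p q : Fin n → Prop} (h : ∀ x, p x → q x) {f} (hf : InM p f) : InM q f := by
  induction hf with
  | base s hs l hl hp => exact .base s hs l hl (fun x hx => h x (hp x hx))
  | add f g _ _ h1 h2 => exact .add f g h1 h2

theorem InM.smul {p : Fin n → Prop} {s} (hs : s ∈ SS n) {f} (hf : InM p f) :
    InM p (fun A => s A • f A) := by
  induction hf with
  | base t ht l hl hp =>
    have := InM.base (p := p) (s * t) ((SS n).mul_mem hs ht) l hl hp
    simpa [mul_smul] using this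
  | add f g _ _ h1 h2 =>
    have := InM.add _ _ h1 h2
    simpa [smul_add] using this

theorem InM.word {p : Fin n → Prop} (l : List (Fin n)) (hl : l.Pairwise (· < ·))
      (hp : ∀ x ∈ l, p x) : InM p (fun A => mx (wl l A)) := by
  have := InM.base (p := p) 1 (SS n).one_mem l hl hp
  simpa using this

theorem InM.neg {p : Fin n → Prop} {f} (hf : InM p f) : InM p (fun A => - f A) := by
  have := hf.smul (s := -1) ((SS n).neg_mem (SS n).one_mem)
  simpa using this

theorem t1_mem (i : Fin n) : (fun A : Fin n → SL2C => tr (A i)) ∈ SS n := by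
  have := mem_SS [i] (by simp)
  simpa [wl, mx_mul, mx_one] using this

theorem t2_mem {i j : Fin n} (h : i < j) : (fun A : Fin n → SL2C => tr (A i * A j)) ∈ SS n := by
  have := mem_SS [i, j] (by simp [h])
  simpa [wl, mx_mul, mx_one] using this

theorem InM.cons (j : Fin n) {p : Fin n → Prop} {f} (hf : InM (fun x => p x ∧ j < x) f)
    (hj : p j) : InM p (fun A => mx (A j) * f A) := by
  induction hf with
  | base s hs l hl hp =>
    have := InM.base (p := p) s hs (j :: l)
      (List.pairwise_cons.2 ⟨fun x hx => (hp x hx).2, hl⟩)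
      (by simp only [List.mem_cons, forall_eq_or_imp]; exact ⟨hj, fun x hx => (hp x hx).1⟩)
    simpa [wl, mx_mul, mx_one] using this
  | add f g _ _ h1 h2 =>
    have := InM.add _ _ h1 h2
    simpa [mul_add] using this

theorem InM.left_word (i : Fin n) (l : List (Fin n)) : ∀ (p : Fin n → Prop), p i →
    l.Pairwise (· < ·) → (∀ x ∈ l, p x) → InM p (fun A => mx (A i) * mx (wl l A)) := by
  induction l with
  | nil =>
    intro p hi _ _
    have := InM.word (p := p) [i] (by simp) (by simpa using hi)
    simpa [wl, mx_mul, mx_one] using this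
  | cons j l ih =>
    intro p hi hl hp
    have hl' := List.pairwise_cons.1 hl
    have hpj : p j := hp j (by simp)
    have hpl : ∀ x ∈ l, p x := fun x hx => hp x (by simp [hx])
    rcases lt_trichotomy i j with h | h | h
    · have := InM.word (p := p) (i :: j :: l) (by
        refine List.pairwise_cons.2 ⟨?_, hl⟩
        intro x hx
        rcases List.mem_cons.1 hx with rfl | hx
        · exact h
        · exact h.trans (hl'.1 x hx)) (by
        intro x hx
        rcases List.mem_cons.1 hx with rfl | hx
        · exact hi
        · exact hp x hx)
      simpa [wl, mx_mul, mx_one] using this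
    · subst h
      have h1 := (InM.word (p := p) (i :: l) hl hp).smul (t1_mem i)
      have h2 := (InM.word (p := p) l hl'.2 hpl).neg
      have := h1.add _ _ h2
      convert this using 2 with A
      simp only [wl, List.map_cons, List.prod_cons, mx_mul]
      rw [← mul_assoc, mx_sq (A i)]
      simp [add_mul, sub_eq_add_neg]
    · have h0 := ih (fun x => p x ∧ j < x) ⟨hi, h⟩ hl'.2 (fun x hx => ⟨hpl x hx, hl'.1 x hx⟩)
      have h1 := (h0.cons j hpj).neg
      have h2 := (InM.word (p := p) (j :: l) hl hp).smul (t1_mem i)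
      have h3 := (h0.mono (q := p) (fun x hx => hx.1)).smul (t1_mem j)
      have h4 := (InM.word (p := p) l hl'.2 hpl).smul ((SS n).sub_mem (t2_mem h)
        ((SS n).mul_mem (t1_mem i) (t1_mem j)))
      have := (((h1.add _ _ h2).add _ _ h3)).add _ _ h4
      convert this using 2 with A
      simp only [wl, List.map_cons, List.prod_cons, mx_mul]
      rw [← mul_assoc, mx_anti (A i) (A j)]
      simp [add_mul, mul_assoc]

theorem InM.left (i : Fin n) {f} (hf : InM (fun _ => True) f) :
    InM (fun _ => True) (fun A => mx (A i) * f A) := by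
  induction hf with
  | base s hs l hl hp =>
    have := (InM.left_word i l (fun _ => True) trivial hl hp).smul hs
    simpa using this
  | add f g _ _ h1 h2 =>
    have := InM.add _ _ h1 h2
    simpa [mul_add] using this

theorem InM.left_group (g : FreeGroup (Fin n)) : ∀ f, InM (fun _ => True) f →
    InM (fun _ => True) (fun A => mx (FreeGroup.lift A g) * f A) := by
  induction g using FreeGroup.induction_on with
  | C1 => intro f hf; simpa [mx_one] using hf
  | of i => intro f hf; simpa using hf.left i
  | inv_of i _ =>
    intro f hf
    have := ((hf.smul (t1_mem i)).add _ _ (hf.left i).neg)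
    convert this using 2 with A
    simp only [map_inv, FreeGroup.lift_apply_of, mx_inv]
    simp [add_mul, sub_eq_add_neg]
  | mul g h hg hh =>
    intro f hf
    have := hg _ (hh f hf)
    simpa [mul_assoc, mx_mul] using this

theorem InM.trace_mem {p : Fin n → Prop} {f} (hf : InM p f) :
    (fun A => Matrix.trace (f A)) ∈ SS n := by
  induction hf with
  | base s hs l hl hp =>
    have := (SS n).mul_mem hs (mem_SS l hl)
    convert this using 1
    ext A; simp [tr]
  | add f g _ _ h1 h2 =>
    have := (SS n).add_mem h1 h2
    convert this using 1
    ext A; simp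

/-- every trace function is an integer polynomial in the basic ones -/
theorem horowitz (g : FreeGroup (Fin n)) : (fun A => tr (rho n A g)) ∈ SS n := by
  have := (InM.left_group g _ (InM.word (p := fun _ => True) [] (by simp) (by simp))).trace_mem
  simpa [wl, tr, rho, mx_one] using this

theorem rho_wI (A : Fin n → SL2C) (I : Finset (Fin n)) :
    rho n A (wI n I) = wl (I.sort (· ≤ ·)) A := by
  simp [rho, wI, wl, map_list_prod, Function.comp_def]

theorem wl_eq (l : List (Fin n)) (hl : l.Pairwise (· < ·)) (A : Fin n → SL2C) :
    wl l A = rho n A (wI n l.toFinset) := by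
  rw [rho_wI, (List.toFinset_sort (r := (· ≤ ·)) (hl.imp ne_of_lt)).2 (hl.imp le_of_lt)]

theorem horowitz_dep (g : FreeGroup (Fin n)) (A B : Fin n → SL2C)
    (h : ∀ I : Finset (Fin n), I.Nonempty → tr (rho n A (wI n I)) = tr (rho n B (wI n I))) :
    tr (rho n A g) = tr (rho n B g) := by
  have h' : ∀ I : Finset (Fin n), tr (rho n A (wI n I)) = tr (rho n B (wI n I)) := by
    intro I
    rcases I.eq_empty_or_nonempty with rfl | hI
    · simp [wI]
    · exact h I hI
  have key : ∀ f ∈ SS n, f A = f B := by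
    intro f hf
    induction hf using Subring.closure_induction with
    | mem f hf =>
      obtain ⟨l, hl, rfl⟩ := hf
      simp only [wl_eq l hl]
      exact h' _
    | zero => rfl
    | one => rfl
    | add f g _ _ h1 h2 => simp [h1, h2]
    | mul f g _ _ h1 h2 => simp [h1, h2]
    | neg f _ h1 => simp [h1]
  exact key _ (horowitz g)

theorem horowitz_mem (g : FreeGroup (Fin n)) (A : Fin n → SL2C) (S : Subring ℂ)
    (h : ∀ I : Finset (Fin n), tr (rho n A (wI n I)) ∈ S) : tr (rho n A g) ∈ S := by
  have key : ∀ f ∈ SS n, f A ∈ S := by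
    intro f hf
    induction hf using Subring.closure_induction with
    | mem f hf =>
      obtain ⟨l, hl, rfl⟩ := hf
      simp only [wl_eq l hl]
      exact h _
    | zero => exact S.zero_mem
    | one => exact S.one_mem
    | add f g _ _ h1 h2 => exact S.add_mem h1 h2
    | mul f g _ _ h1 h2 => exact S.mul_mem h1 h2
    | neg f _ h1 => exact S.neg_mem h1
  exact key _ (horowitz g)
end horo

/-- Markov function -/
def kap (p : ℝ × ℝ × ℝ) : ℝ :=
  p.1 ^ 2 + p.2.1 ^ 2 + p.2.2 ^ 2 - p.1 * p.2.1 * p.2.2 - 2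
/-- size -/
def siz (p : ℝ × ℝ × ℝ) : ℝ := p.1 ^ 2 + p.2.1 ^ 2 + p.2.2 ^ 2

theorem real_ineq_pos (x y z k : ℝ) (hx : 0 < x) (hxy : x ≤ y) (hyz : y ≤ z) (hz : z ≤ 2)
    (hk : x ^ 2 + y ^ 2 + z ^ 2 - x * y * z - 2 = k) (h : y * z - x ≤ x) : k ≤ 2 := by
  by_contra hk2
  push Not at hk2
  have h1 : (2 * x - y * z) ^ 2 = (4 - y ^ 2) * (4 - z ^ 2) + 4 * (k - 2) := by
    rw [← hk]; ring
  have h2 : 0 ≤ 2 * x - y * z := by linarith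
  have h3 : 2 * x - y * z ≤ y * (2 - z) := by nlinarith
  have h4 : (2 * x - y * z) ^ 2 ≤ (y * (2 - z)) ^ 2 := by gcongr
  have h5 : y ^ 2 ≤ 2 + z := by nlinarith
  have h6 : (y * (2 - z)) ^ 2 ≤ (4 - y ^ 2) * (4 - z ^ 2) := by
    have : (4 - y ^ 2) * (4 - z ^ 2) - (y * (2 - z)) ^ 2 = (2 - z) * (4 * (2 + z - y ^ 2)) := by
      ring
    have h7 : 0 ≤ (2 - z) * (4 * (2 + z - y ^ 2)) :=
      mul_nonneg (by linarith) (by linarith)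
    linarith
  linarith

theorem real_ineq_pos' (x y z k : ℝ) (hx : 0 < x) (hy : 0 < y) (hz : 0 < z)
    (hx2 : x ≤ 2) (hy2 : y ≤ 2) (hz2 : z ≤ 2)
    (hk : x ^ 2 + y ^ 2 + z ^ 2 - x * y * z - 2 = k) (h1 : y * z - x ≤ x)
    (h2 : x * z - y ≤ y) (h3 : x * y - z ≤ z) : k ≤ 2 := by
  rcases le_total x y with a | a <;> rcases le_total y z with b | b <;>
    rcases le_total x z with c | c
  · exact real_ineq_pos x y z k hx a b hz2 hk h1
  · exact real_ineq_pos x y z k hx a b hz2 hk h1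
  · exact real_ineq_pos x z y k hx c b hy2 (by linarith) (by linarith)
  · exact real_ineq_pos z x y k hz c a hy2 (by linarith) (by linarith)
  · exact real_ineq_pos y x z k hy a c hz2 (by linarith) (by linarith)
  · exact real_ineq_pos y z x k hy b c hx2 (by linarith) (by linarith)
  · exact real_ineq_pos z y x k hz b a hx2 (by linarith) (by linarith)
  · exact real_ineq_pos z y x k hz b a hx2 (by linarith) (by linarith)

theorem real_ineq (x y z k : ℝ) (hx2 : |x| ≤ 2) (hy2 : |y| ≤ 2) (hz2 : |z| ≤ 2)
    (hk : x ^ 2 + y ^ 2 + z ^ 2 - x * y * z - 2 = k) (h1 : |y * z - x| ≤ |x|)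
    (h2 : |x * z - y| ≤ |y|) (h3 : |x * y - z| ≤ |z|) : k ≤ 2 := by
  rw [abs_le] at hx2 hy2 hz2
  rw [← sq_le_sq] at h1 h2 h3
  rcases lt_or_ge 0 (x * y * z) with h | h
  · have hx : x ≠ 0 := by rintro rfl; simp at h
    have hy : y ≠ 0 := by rintro rfl; simp at h
    have hz : z ≠ 0 := by rintro rfl; simp at h
    rcases lt_or_gt_of_ne hx with a | a <;> rcases lt_or_gt_of_ne hy with b | b <;>
      rcases lt_or_gt_of_ne hz with c | c
    · exfalso; nlinarith [mul_pos_of_neg_of_neg a b]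
    · exact real_ineq_pos' (-x) (-y) z k (by linarith) (by linarith) c (by linarith) (by linarith)
        (by linarith) (by linarith) (by nlinarith) (by nlinarith) (by nlinarith)
    · exact real_ineq_pos' (-x) y (-z) k (by linarith) (by linarith) (by linarith) (by linarith) (by linarith)
        (by linarith) (by linarith) (by nlinarith) (by nlinarith) (by nlinarith)
    · exfalso; nlinarith [mul_pos b c]
    · exact real_ineq_pos' x (-y) (-z) k (by linarith) (by linarith) (by linarith) (by linarith) (by linarith)
        (by linarith) (by linarith) (by nlinarith) (by nlinarith) (by nlinarith)
    · exfalso; nlinarith [mul_pos a c]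
    · exfalso; nlinarith [mul_pos a b]
    · exact real_ineq_pos' x y z k a b c (by linarith) (by linarith)
        (by linarith) (by linarith) (by nlinarith) (by nlinarith) (by nlinarith)
  · have e1 : y * z = 0 := by
      have : (y * z) ^ 2 ≤ 0 := by nlinarith
      exact pow_eq_zero_iff (two_ne_zero) |>.1 (le_antisymm this (sq_nonneg _))
    have e2 : x * z = 0 := by
      have : (x * z) ^ 2 ≤ 0 := by nlinarith
      exact pow_eq_zero_iff (two_ne_zero) |>.1 (le_antisymm this (sq_nonneg _))
    have e3 : x * y = 0 := by
      have : (x * y) ^ 2 ≤ 0 := by nlinarith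
      exact pow_eq_zero_iff (two_ne_zero) |>.1 (le_antisymm this (sq_nonneg _))
    rcases mul_eq_zero.1 e1 with rfl | rfl
    · rcases mul_eq_zero.1 e2 with rfl | rfl <;> nlinarith
    · rcases mul_eq_zero.1 e3 with rfl | rfl <;> nlinarith

theorem no_big (S : Set (ℝ × ℝ × ℝ)) (hb : ∀ p ∈ S, |p.1| ≤ 2 ∧ |p.2.1| ≤ 2 ∧ |p.2.2| ≤ 2)
    (v1 : ∀ p ∈ S, (p.2.1 * p.2.2 - p.1, p.2.1, p.2.2) ∈ S)
    (v2 : ∀ p ∈ S, (p.1, p.1 * p.2.2 - p.2.1, p.2.2) ∈ S)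
    (v3 : ∀ p ∈ S, (p.1, p.2.1, p.1 * p.2.1 - p.2.2) ∈ S) : ∀ p ∈ S, kap p ≤ 2 := by
  intro p hp
  let S' : Set (ℝ × ℝ × ℝ) := {q | q ∈ S ∧ kap q = kap p}
  let C := closure S'
  have hC : ∀ q ∈ C, (|q.1| ≤ 2 ∧ |q.2.1| ≤ 2 ∧ |q.2.2| ≤ 2) ∧ kap q = kap p := by
    have hcl : IsClosed {q : ℝ × ℝ × ℝ |
        (|q.1| ≤ 2 ∧ |q.2.1| ≤ 2 ∧ |q.2.2| ≤ 2) ∧ kap q = kap p} := by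
      have hk : Continuous kap := by unfold kap; fun_prop
      refine IsClosed.inter (IsClosed.inter ?_ (IsClosed.inter ?_ ?_)) ?_
      · exact isClosed_le (continuous_abs.comp continuous_fst) continuous_const
      · exact isClosed_le (continuous_abs.comp (continuous_fst.comp continuous_snd)) continuous_const
      · exact isClosed_le (continuous_abs.comp (continuous_snd.comp continuous_snd)) continuous_const
      · exact isClosed_eq hk continuous_const
    intro q hq
    have hsub : S' ⊆ {q : ℝ × ℝ × ℝ |
        (|q.1| ≤ 2 ∧ |q.2.1| ≤ 2 ∧ |q.2.2| ≤ 2) ∧ kap q = kap p} :=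
      fun q hq => ⟨hb q hq.1, hq.2⟩
    exact closure_minimal hsub hcl hq
  have hcomp : IsCompact C := by
    refine IsCompact.of_isClosed_subset
      (isCompact_Icc (a := ((-2, -2, -2) : ℝ × ℝ × ℝ)) (b := (2, 2, 2))) isClosed_closure ?_
    intro q hq
    obtain ⟨⟨a, b, c⟩, -⟩ := hC q hq
    rw [abs_le] at a b c
    exact ⟨⟨a.1, b.1, c.1⟩, ⟨a.2, b.2, c.2⟩⟩
  have hne : C.Nonempty := ⟨p, subset_closure ⟨hp, rfl⟩⟩
  obtain ⟨q, hq, hmax⟩ := hcomp.exists_isMaxOn hne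
    (f := siz) (by unfold siz; fun_prop)
  have V (f : ℝ × ℝ × ℝ → ℝ × ℝ × ℝ) (hf : Continuous f) (hS : ∀ q ∈ S, f q ∈ S)
      (hk : ∀ q, kap (f q) = kap q) : siz (f q) ≤ siz q := by
    refine hmax (map_mem_closure hf hq ?_)
    intro r hr
    exact ⟨hS r hr.1, (hk r).trans hr.2⟩
  have w1 := V (fun p => (p.2.1 * p.2.2 - p.1, p.2.1, p.2.2)) (by fun_prop) v1
    (by intro q; simp only [kap]; ring)
  have w2 := V (fun p => (p.1, p.1 * p.2.2 - p.2.1, p.2.2)) (by fun_prop) v2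
    (by intro q; simp only [kap]; ring)
  have w3 := V (fun p => (p.1, p.2.1, p.1 * p.2.1 - p.2.2)) (by fun_prop) v3
    (by intro q; simp only [kap]; ring)
  simp only [siz] at w1 w2 w3
  obtain ⟨⟨a, b, c⟩, d⟩ := hC q hq
  exact real_ineq q.1 q.2.1 q.2.2 (kap p) a b c d (sq_le_sq.1 (by linarith))
    (sq_le_sq.1 (by linarith)) (sq_le_sq.1 (by linarith))

section autos
variable {n : ℕ}

/-- transvection `a_j ↦ a_i a_j` -/
def tv (i j : Fin n) (h : i ≠ j) : MulAut (FreeGroup (Fin n)) :=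
  MonoidHom.toMulEquiv
    (FreeGroup.lift fun k => if k = j then FreeGroup.of i * FreeGroup.of k else FreeGroup.of k)
    (FreeGroup.lift fun k => if k = j then (FreeGroup.of i)⁻¹ * FreeGroup.of k
      else FreeGroup.of k)
    (by
      ext k
      by_cases hk : k = j
      · subst hk; simp [h]
      · simp [hk])
    (by
      ext k
      by_cases hk : k = j
      · subst hk; simp [h]
      · simp [hk])

theorem tv_self (i j : Fin n) (h : i ≠ j) :
    tv i j h (FreeGroup.of j) = FreeGroup.of i * FreeGroup.of j := by
  simp [tv, MonoidHom.toMulEquiv]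

theorem tv_ne (i j : Fin n) (h : i ≠ j) (k : Fin n) (hk : k ≠ j) :
    tv i j h (FreeGroup.of k) = FreeGroup.of k := by
  simp [tv, MonoidHom.toMulEquiv, hk]

/-- inversion of a generator -/
def iv (j : Fin n) : MulAut (FreeGroup (Fin n)) :=
  MonoidHom.toMulEquiv
    (FreeGroup.lift fun k => if k = j then (FreeGroup.of k)⁻¹ else FreeGroup.of k)
    (FreeGroup.lift fun k => if k = j then (FreeGroup.of k)⁻¹ else FreeGroup.of k)
    (by
      ext k
      by_cases hk : k = j
      · subst hk; simp
      · simp [hk])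
    (by
      ext k
      by_cases hk : k = j
      · subst hk; simp
      · simp [hk])

theorem iv_self (j : Fin n) : iv j (FreeGroup.of j) = (FreeGroup.of j)⁻¹ := by
  simp [iv, MonoidHom.toMulEquiv]

theorem iv_ne (j : Fin n) (k : Fin n) (hk : k ≠ j) :
    iv j (FreeGroup.of k) = FreeGroup.of k := by
  simp [iv, MonoidHom.toMulEquiv, hk]

theorem tv_pow (i j : Fin n) (h : i ≠ j) (k : ℕ) :
    (tv i j h ^ k) (FreeGroup.of j) = FreeGroup.of i ^ k * FreeGroup.of j := by
  induction k with
  | zero => simp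
  | succ k ih =>
    rw [pow_succ', MulAut.mul_apply, ih, map_mul, map_pow, tv_self, tv_ne _ _ _ _ h, pow_succ,
      mul_assoc]

theorem prim_list (l : List (Fin n)) (hl : l.Nodup) (hne : l ≠ []) :
    ∃ (α : MulAut (FreeGroup (Fin n))) (i : Fin n), i ∈ l ∧
      α (FreeGroup.of i) = (l.map FreeGroup.of).prod ∧
      ∀ k, k ∉ l → α (FreeGroup.of k) = FreeGroup.of k := by
  induction l with
  | nil => exact absurd rfl hne
  | cons j l ih =>
    by_cases h : l = []
    · subst h
      exact ⟨1, j, by simp, by simp, by simp⟩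
    · obtain ⟨hj, hl'⟩ := List.nodup_cons.1 hl
      obtain ⟨α, i, hi, h1, h2⟩ := ih hl' h
      have hji : j ≠ i := fun e => hj (e ▸ hi)
      refine ⟨α * tv j i hji, i, by simp [hi], ?_, ?_⟩
      · rw [MulAut.mul_apply, tv_self, map_mul, h1, h2 j hj]; simp
      · intro k hk
        simp only [List.mem_cons, not_or] at hk
        rw [MulAut.mul_apply, tv_ne j i hji k (fun e => hk.2 (e ▸ hi)), h2 k hk.2]

theorem prim_wI (I : Finset (Fin n)) (hI : I.Nonempty) :
    ∃ (α : MulAut (FreeGroup (Fin n))) (i : Fin n), α (FreeGroup.of i) = wI n I := by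
  obtain ⟨α, i, -, h, -⟩ := prim_list (I.sort (· ≤ ·)) (I.sort_nodup (· ≤ ·)) (by
    intro h
    obtain ⟨x, hx⟩ := hI
    have : x ∈ I.sort (· ≤ ·) := (Finset.mem_sort _).2 hx
    rw [h] at this
    simp at this)
  exact ⟨α, i, h⟩

/-- primitive elements have finite order -/
def PF (φ : FreeGroup (Fin n) →* SL2C) : Prop :=
  ∀ (α : MulAut (FreeGroup (Fin n))) (i : Fin n), IsOfFinOrder (φ (α (FreeGroup.of i)))

/-- twist traces take finitely many values -/
def HH (φ : FreeGroup (Fin n) →* SL2C) : Prop :=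
  ∀ (α : MulAut (FreeGroup (Fin n))) (i j : Fin n), i ≠ j →
    (Set.range fun k : ℕ => tr (φ (α (FreeGroup.of i)) ^ k * φ (α (FreeGroup.of j)))).Finite

/-- irreducibility -/
def Irr (φ : FreeGroup (Fin n) →* SL2C) : Prop :=
  ¬ ∃ v : Fin 2 → ℂ, v ≠ 0 ∧ ∀ g, ∃ c : ℂ, mx (φ g) *ᵥ v = c • v

theorem rho_comp (A : Fin n → SL2C) (β : MulAut (FreeGroup (Fin n))) (g : FreeGroup (Fin n)) :
    rho n A (β g) = rho n (fun i => rho n A (β (FreeGroup.of i))) g := by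
  have : (rho n A).comp β.toMonoidHom = rho n (fun i => rho n A (β (FreeGroup.of i))) := by
    ext i : 1
    simp [rho]
  exact DFunLike.congr_fun this g

theorem finite_range_of_dep {ι X Y : Type*} (f : ι → X) (g : ι → Y)
    (hf : (Set.range f).Finite) (h : ∀ a b, f a = f b → g a = g b) : (Set.range g).Finite := by
  classical
  rcases isEmpty_or_nonempty ι with _ | _
  · exact Set.toFinite _
  refine (hf.image (fun x => g (Function.invFun f x))).subset ?_
  rintro _ ⟨a, rfl⟩
  exact ⟨f a, ⟨a, rfl⟩, h _ _ (Function.invFun_eq ⟨a, rfl⟩)⟩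

theorem HH_of_per (A : Fin n → SL2C) (h : ElemPeriodic n A) : HH (rho n A) := by
  intro α i j hij
  refine finite_range_of_dep _ _ (h (α * tv i j hij * α⁻¹)) ?_
  intro k l hkl
  have key : ∀ k : ℕ, rho n A (α (FreeGroup.of i)) ^ k * rho n A (α (FreeGroup.of j))
      = rho n A (((α * tv i j hij * α⁻¹) ^ k) (α (FreeGroup.of j))) := by
    intro k
    rw [conj_pow, MulAut.mul_apply, MulAut.mul_apply, MulAut.inv_apply_self, tv_pow]
    simp
  rw [key, key, rho_comp, rho_comp A (_ ^ l)]
  refine horowitz_dep _ _ _ fun I hI => ?_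
  have := congrFun hkl ⟨I, hI⟩
  simp only [chi] at this
  rw [← rho_comp, ← rho_comp]
  exact (div_left_inj' two_ne_zero).1 this

theorem irr_gens (φ : FreeGroup (Fin n) →* SL2C) (α : MulAut (FreeGroup (Fin n)))
    (v : Fin 2 → ℂ) (hv : ∀ i, ∃ c : ℂ, mx (φ (α (FreeGroup.of i))) *ᵥ v = c • v) :
    ∀ g, ∃ c : ℂ, mx (φ g) *ᵥ v = c • v := by
  have key : ∀ g, ∃ c : ℂ, mx (φ (α g)) *ᵥ v = c • v := by
    intro g
    induction g using FreeGroup.induction_on with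
    | C1 => exact ⟨1, by simp [mx_one]⟩
    | of i => exact hv i
    | inv_of i ih =>
      obtain ⟨c, hc⟩ := ih
      refine ⟨tr (φ (α (FreeGroup.of i))) - c, ?_⟩
      rw [map_inv, map_inv, mx_inv, sub_mulVec, hc, sub_smul]
      simp [smul_mulVec]
    | mul x y hx hy =>
      obtain ⟨c, hc⟩ := hx
      obtain ⟨d, hd⟩ := hy
      refine ⟨c * d, ?_⟩
      rw [map_mul, map_mul, mx_mul, ← mulVec_mulVec, hd, mulVec_smul, hc, smul_smul, mul_comm]
  intro g
  simpa using key (α⁻¹ g)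

/-- conjugation and change of basis -/
def cj (P : SL2C) (α : MulAut (FreeGroup (Fin n))) (φ : FreeGroup (Fin n) →* SL2C) :
    FreeGroup (Fin n) →* SL2C :=
  ((MulAut.conj P⁻¹).toMonoidHom.comp φ).comp α.toMonoidHom

theorem cj_apply (P : SL2C) (α : MulAut (FreeGroup (Fin n))) (φ : FreeGroup (Fin n) →* SL2C) (g) :
    cj P α φ g = P⁻¹ * φ (α g) * P := by
  simp [cj]

theorem tr_conj (P X : SL2C) : tr (P⁻¹ * X * P) = tr X := by
  rw [tr_mul_comm]; simp

theorem cj_tr (P : SL2C) (α : MulAut (FreeGroup (Fin n))) (φ : FreeGroup (Fin n) →* SL2C) (g) :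
    tr (cj P α φ g) = tr (φ (α g)) := by
  rw [cj_apply, tr_conj]

theorem cj_PF (P : SL2C) (α : MulAut (FreeGroup (Fin n))) {φ : FreeGroup (Fin n) →* SL2C}
    (h : PF φ) : PF (cj P α φ) := by
  intro β i
  have := (h (α * β) i)
  exact MonoidHom.isOfFinOrder (MulAut.conj P⁻¹).toMonoidHom this

theorem cj_HH (P : SL2C) (α : MulAut (FreeGroup (Fin n))) {φ : FreeGroup (Fin n) →* SL2C}
    (h : HH φ) : HH (cj P α φ) := by
  intro β i j hij
  have := (h (α * β) i j hij)
  convert this using 3 with k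
  rw [← map_pow, ← map_mul, cj_tr]
  simp

theorem cj_Irr (P : SL2C) (α : MulAut (FreeGroup (Fin n))) {φ : FreeGroup (Fin n) →* SL2C}
    (h : Irr φ) : Irr (cj P α φ) := by
  rintro ⟨v, hv, hg⟩
  have hP : mx P⁻¹ * mx P = 1 := by rw [← mx_mul]; simp [mx_one]
  have hP' : mx P * mx P⁻¹ = 1 := by rw [← mx_mul]; simp [mx_one]
  refine h ⟨mx P *ᵥ v, ?_, ?_⟩
  · intro e
    apply hv
    have : mx P⁻¹ *ᵥ (mx P *ᵥ v) = 0 := by rw [e]; simp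
    rwa [mulVec_mulVec, hP, one_mulVec] at this
  · intro g
    obtain ⟨c, hc⟩ := hg (α⁻¹ g)
    refine ⟨c, ?_⟩
    rw [cj_apply, MulAut.apply_inv_self, mx_mul, mx_mul] at hc
    rw [← mulVec_smul, ← hc]
    rw [mulVec_mulVec, mulVec_mulVec, ← mul_assoc, ← mul_assoc, hP', one_mul]

theorem map_Irr (σ : ℂ ≃+* ℂ) {φ : FreeGroup (Fin n) →* SL2C} (h : Irr φ) :
    Irr ((SpecialLinearGroup.map (σ : ℂ →+* ℂ)).comp φ) := by
  rintro ⟨v, hv, hg⟩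
  refine h ⟨fun i => σ.symm (v i), ?_, ?_⟩
  · intro e
    apply hv
    ext i
    have := congrFun e i
    simpa using this
  · intro g
    obtain ⟨c, hc⟩ := hg g
    refine ⟨σ.symm c, ?_⟩
    ext i
    have h1 := congrFun hc i
    apply σ.injective
    simp only [mx, MonoidHom.comp_apply, SpecialLinearGroup.map_apply_coe, mulVec, dotProduct,
      Fin.sum_univ_two, Pi.smul_apply, smul_eq_mul, RingHom.mapMatrix_apply, map_apply] at h1
    simp only [mx, mulVec, dotProduct, Fin.sum_univ_two, Pi.smul_apply, smul_eq_mul, map_add,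
      map_mul, RingEquiv.apply_symm_apply]
    exact h1

theorem map_PF (σ : ℂ ≃+* ℂ) {φ : FreeGroup (Fin n) →* SL2C} (h : PF φ) :
    PF ((SpecialLinearGroup.map (σ : ℂ →+* ℂ)).comp φ) := by
  intro α i
  exact MonoidHom.isOfFinOrder (SpecialLinearGroup.map (σ : ℂ →+* ℂ)) (h α i)

theorem map_tr (σ : ℂ ≃+* ℂ) (X : SL2C) :
    tr (SpecialLinearGroup.map (σ : ℂ →+* ℂ) X) = σ (tr X) := by
  simp [tr_eq, mx, SpecialLinearGroup.map_apply_coe]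
end autos


/-- build an element of SL2 -/
def mk2 (a b c d : ℂ) (h : a * d - b * c = 1) : SL2C :=
  ⟨!![a, b; c, d], by simp [Matrix.det_fin_two, h]⟩

theorem mx_mk2 (a b c d : ℂ) (h : a * d - b * c = 1) : mx (mk2 a b c d h) = !![a, b; c, d] := rfl

theorem inv_entries (X : SL2C) : mx X⁻¹ 0 0 = mx X 1 1 ∧ mx X⁻¹ 0 1 = - mx X 0 1 ∧
    mx X⁻¹ 1 0 = - mx X 1 0 ∧ mx X⁻¹ 1 1 = mx X 0 0 := by
  rw [mx_inv, tr_eq]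
  refine ⟨?_, ?_, ?_, ?_⟩ <;> simp

theorem mul_entries (X Y : SL2C) : 
    mx (X * Y) 0 0 = mx X 0 0 * mx Y 0 0 + mx X 0 1 * mx Y 1 0 ∧ 
    mx (X * Y) 0 1 = mx X 0 0 * mx Y 0 1 + mx X 0 1 * mx Y 1 1 ∧
    mx (X * Y) 1 0 = mx X 1 0 * mx Y 0 0 + mx X 1 1 * mx Y 1 0 ∧ 
    mx (X * Y) 1 1 = mx X 1 0 * mx Y 0 1 + mx X 1 1 * mx Y 1 1 := by
  rw [mx_mul]
  refine ⟨?_, ?_, ?_, ?_⟩ <;> simp [Matrix.mul_apply, Fin.sum_univ_two]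

theorem upper_form (X : SL2C) : ∃ P : SL2C, mx (P⁻¹ * X * P) 1 0 = 0 := by
  -- eigenvector
  obtain ⟨l, hl⟩ : ∃ l : ℂ, l ^ 2 - tr X * l + 1 = 0 := by
    obtain ⟨s, hs⟩ := IsAlgClosed.exists_pow_nat_eq (tr X ^ 2 - 4) (n := 2) (by norm_num)
    refine ⟨(tr X + s) / 2, ?_⟩
    linear_combination hs / 4
  have hdet : ((mx X - l • (1 : Matrix (Fin 2) (Fin 2) ℂ))).det = 0 := by
    have := det_eq X
    rw [tr_eq] at hl
    rw [Matrix.det_fin_two]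
    simp
    linear_combination hl + this
  obtain ⟨v, hv, hXv⟩ := Matrix.exists_mulVec_eq_zero_iff.2 hdet
  have h0 := congrFun hXv 0
  have h1 := congrFun hXv 1
  simp [mulVec, dotProduct, Fin.sum_univ_two] at h0 h1
  -- complete v to a basis
  have : ∃ P : SL2C, mx P 0 0 = v 0 ∧ mx P 1 0 = v 1 := by
    by_cases hv0 : v 0 = 0
    · have hv1 : v 1 ≠ 0 := by
        intro h
        apply hv
        ext i; fin_cases i <;> simp [hv0, h]
      exact ⟨mk2 (v 0) (-(v 1)⁻¹) (v 1) 0 (by field_simp; simp), by simp [mx_mk2], by simp [mx_mk2]⟩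
    · exact ⟨mk2 (v 0) 0 (v 1) (v 0)⁻¹ (by field_simp; simp), by simp [mx_mk2], by simp [mx_mk2]⟩
  obtain ⟨P, hP0, hP1⟩ := this
  refine ⟨P, ?_⟩
  rw [mul_assoc, (mul_entries _ _).2.2.1, (inv_entries P).2.2.1, (inv_entries P).2.2.2,
    (mul_entries _ _).1, (mul_entries _ _).2.2.1, hP0, hP1]
  linear_combination (-(v 1)) * h0 + v 0 * h1

theorem normal_form (X : SL2C) : ∃ P : SL2C, mx (P⁻¹ * X * P) 1 0 = 0 ∧
    (mx (P⁻¹ * X * P) 0 1 = 0 ∨ mx (P⁻¹ * X * P) 0 0 = mx (P⁻¹ * X * P) 1 1) := by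
  obtain ⟨P, hP⟩ := upper_form X
  by_cases h : mx (P⁻¹ * X * P) 0 0 = mx (P⁻¹ * X * P) 1 1
  · exact ⟨P, hP, Or.inr h⟩
  · set Y := P⁻¹ * X * P with hY
    have hne : mx Y 1 1 - mx Y 0 0 ≠ 0 := sub_ne_zero.2 (Ne.symm h)
    let Q := mk2 1 (mx Y 0 1 / (mx Y 1 1 - mx Y 0 0)) 0 1 (by simp)
    have e : (P * Q)⁻¹ * X * (P * Q) = Q⁻¹ * (Y * Q) := by rw [hY]; group
    refine ⟨P * Q, ?_, Or.inl ?_⟩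
    · rw [e, (mul_entries _ _).2.2.1, (inv_entries Q).2.2.1, (inv_entries Q).2.2.2,
        (mul_entries _ _).1, (mul_entries _ _).2.2.1]
      simp [Q, mx_mk2, hP]
    · rw [e, (mul_entries _ _).2.1, (inv_entries Q).1, (inv_entries Q).2.1,
        (mul_entries _ _).2.1, (mul_entries _ _).2.2.2]
      simp [Q, mx_mk2, hP]
      field_simp
      ring

theorem upper_pow (X : SL2C) (h : mx X 1 0 = 0) (k : ℕ) : mx (X ^ k) 1 0 = 0 ∧
    mx (X ^ k) 0 0 = mx X 0 0 ^ k ∧ mx (X ^ k) 1 1 = mx X 1 1 ^ k ∧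
    (mx X 0 1 = 0 → mx (X ^ k) 0 1 = 0) ∧
    (mx X 0 0 = mx X 1 1 → mx (X ^ k) 0 1 = mx X 0 0 ^ k * (k * mx X 0 0 * mx X 0 1)) := by
  induction k with
  | zero => simp [mx_one]
  | succ k ih =>
    obtain ⟨a, b, c, d, e⟩ := ih
    rw [pow_succ, (mul_entries _ _).1, (mul_entries _ _).2.1, (mul_entries _ _).2.2.1,
      (mul_entries _ _).2.2.2, a, b, c, h]
    refine ⟨by simp, by simp [pow_succ], by simp [pow_succ], ?_, ?_⟩
    · intro h1; simp [h1, d h1]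
    · intro h1
      rw [e h1]
      have := det_eq X
      rw [h, ← h1] at this
      rw [← h1]
      push_cast
      linear_combination (- mx X 0 0 ^ k * mx X 0 1) * this

theorem fin_exp (a p q : ℂ) (ha0 : a ≠ 0) (ha : ∀ m : ℕ, 0 < m → a ^ m ≠ 1)
    (hf : (Set.range fun k : ℕ => a ^ k * p + a⁻¹ ^ k * q).Finite) : p = 0 ∧ q = 0 := by
  have hinj : Function.Injective (fun k : ℕ => a ^ k) := by
    have aux : ∀ k l : ℕ, k < l → a ^ k ≠ a ^ l := by
      intro k l hkl e
      apply ha (l - k) (by omega)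
      have : a ^ l = a ^ k * a ^ (l - k) := by rw [← pow_add]; congr 1; omega
      rw [this] at e
      exact (mul_left_cancel₀ (pow_ne_zero k ha0) (by simpa using e)).symm
    intro k l e
    rcases lt_trichotomy k l with h | h | h
    · exact absurd e (aux k l h)
    · exact h
    · exact absurd e.symm (aux l k h)
  have : Finite (Set.range fun k : ℕ => a ^ k * p + a⁻¹ ^ k * q) := hf
  obtain ⟨⟨c, hcm⟩, hc⟩ := Finite.exists_infinite_fiber
    (Set.rangeFactorization fun k : ℕ => a ^ k * p + a⁻¹ ^ k * q)
  rw [Set.infinite_coe_iff] at hc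
  have hc2 := hc.image hinj.injOn
  let Q : Polynomial ℂ := .C p * .X ^ 2 - .C c * .X + .C q
  have hQ : Q = 0 := by
    refine Polynomial.eq_zero_of_infinite_isRoot Q (hc2.mono ?_)
    rintro _ ⟨k, hk, rfl⟩
    have hk' : a ^ k * p + a⁻¹ ^ k * q = c := congrArg Subtype.val hk
    have h1 : a ^ k * a⁻¹ ^ k = 1 := by rw [← mul_pow, mul_inv_cancel₀ ha0, one_pow]
    simp only [Set.mem_setOf_eq, Polynomial.IsRoot, Q, Polynomial.eval_add, Polynomial.eval_sub,
      Polynomial.eval_mul, Polynomial.eval_C, Polynomial.eval_pow, Polynomial.eval_X]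
    rw [← hk']
    linear_combination (-q) * h1
  have h2 : Q.coeff 2 = 0 := by rw [hQ]; simp
  have h0 : Q.coeff 0 = 0 := by rw [hQ]; simp
  simp [Q, Polynomial.coeff_X, Polynomial.coeff_C] at h2 h0
  exact ⟨h2, h0⟩

theorem fin_lin (a t c : ℂ) (ha : a * a = 1)
    (hf : (Set.range fun k : ℕ => a ^ k * (t + k * c)).Finite) : c = 0 := by
  by_contra hc
  have hf2 := hf.union (hf.image (fun x => -x))
  have hsub : (Set.range fun k : ℕ => t + k * c) ⊆ 
    (Set.range fun k : ℕ => a ^ k * (t + k * c)) ∪ 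
      ((fun x => -x) '' (Set.range fun k : ℕ => a ^ k * (t + k * c))) := by
    rintro _ ⟨k, rfl⟩
    have : a ^ k = 1 ∨ a ^ k = -1 := by
      rcases mul_self_eq_one_iff.1 ha with h | h
      · left; simp [h]
      · rw [h]; exact neg_one_pow_eq_or ℂ k
    rcases this with h | h
    · left; exact ⟨k, by simp [h]⟩
    · right; exact ⟨_, ⟨k, rfl⟩, by simp [h]⟩
  refine Set.infinite_range_of_injective (f := fun k : ℕ => t + k * c) ?_ (hf2.subset hsub)
  intro k l e
  simp only [add_right_inj] at e
  exact_mod_cast mul_right_cancel₀ hc e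

theorem iof_conj (P X : SL2C) : IsOfFinOrder (P⁻¹ * X * P) ↔ IsOfFinOrder X := by
  constructor
  · intro h
    have := MonoidHom.isOfFinOrder (MulAut.conj P).toMonoidHom h
    simpa [mul_assoc] using this
  · intro h
    have := MonoidHom.isOfFinOrder (MulAut.conj P⁻¹).toMonoidHom h
    simpa [mul_assoc] using this

section
variable {n : ℕ}

theorem e1_eig (X : SL2C) (h : mx X 1 0 = 0) : ∃ c : ℂ, mx X *ᵥ ![1, 0] = c • ![1, 0] := by
  refine ⟨mx X 0 0, ?_⟩
  ext i; fin_cases i <;> simp [mulVec, dotProduct, Fin.sum_univ_two, h]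

theorem e2_eig (X : SL2C) (h : mx X 0 1 = 0) : ∃ c : ℂ, mx X *ᵥ ![0, 1] = c • ![0, 1] := by
  refine ⟨mx X 1 1, ?_⟩
  ext i; fin_cases i <;> simp [mulVec, dotProduct, Fin.sum_univ_two, h]

theorem not_all_upper {φ : FreeGroup (Fin n) →* SL2C} (hi : Irr φ) :
    ∃ i, mx (φ (FreeGroup.of i)) 1 0 ≠ 0 := by
  by_contra h
  push Not at h
  exact hi ⟨![1, 0], by simp, irr_gens φ 1 _ (fun i => e1_eig _ (h i))⟩

theorem not_all_lower {φ : FreeGroup (Fin n) →* SL2C} (hi : Irr φ) :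
    ∃ i, mx (φ (FreeGroup.of i)) 0 1 ≠ 0 := by
  by_contra h
  push Not at h
  exact hi ⟨![0, 1], by simp, irr_gens φ 1 _ (fun i => e2_eig _ (h i))⟩

theorem PF_aux (hn : 3 ≤ n) {φ : FreeGroup (Fin n) →* SL2C} (hH : HH φ) (hI : Irr φ) (i : Fin n)
    (hu : mx (φ (FreeGroup.of i)) 1 0 = 0) (hd : mx (φ (FreeGroup.of i)) 0 1 = 0 ∨
      mx (φ (FreeGroup.of i)) 0 0 = mx (φ (FreeGroup.of i)) 1 1) :
    IsOfFinOrder (φ (FreeGroup.of i)) := by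
  set X := φ (FreeGroup.of i) with hX
  have hdet := det_eq X
  rw [hu, mul_zero, sub_zero] at hdet
  by_cases hb : mx X 0 1 = 0
  · -- diagonal
    have ha0 : mx X 0 0 ≠ 0 := by intro h; simp [h] at hdet
    have hinv : mx X 1 1 = (mx X 0 0)⁻¹ := eq_inv_of_mul_eq_one_right hdet
    by_cases hr : ∃ m : ℕ, 0 < m ∧ mx X 0 0 ^ m = 1
    · obtain ⟨m, hm, h1⟩ := hr
      refine isOfFinOrder_iff_pow_eq_one.2 ⟨m, hm, ?_⟩
      obtain ⟨a, b, c, d, -⟩ := upper_pow X hu m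
      apply mx_inj
      ext k l
      fin_cases k <;> fin_cases l <;> simp [a, b, c, d hb, h1, mx_one, hinv]
    · exfalso
      push Not at hr
      have key : ∀ (α : MulAut (FreeGroup (Fin n))) (j : Fin n), i ≠ j →
          α (FreeGroup.of i) = FreeGroup.of i →
          mx (φ (α (FreeGroup.of j))) 0 0 = 0 ∧ mx (φ (α (FreeGroup.of j))) 1 1 = 0 := by
        intro α j hij hα
        apply fin_exp _ _ _ ha0 hr
        have := hH α i j hij
        convert this using 3 with k
        rw [hα, tr_eq, (mul_entries _ _).1, (mul_entries _ _).2.2.2]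
        obtain ⟨a, b, c, d, -⟩ := upper_pow X hu k
        rw [← hX, a, b, c, d hb, hinv]
        ring
      obtain ⟨j, hj⟩ : ∃ j : Fin n, i ≠ j := by
        have : Nontrivial (Fin n) := Fin.nontrivial_iff_two_le.2 (by omega)
        obtain ⟨j, hj⟩ := exists_ne i
        exact ⟨j, hj.symm⟩
      obtain ⟨l, hl⟩ : ∃ l : Fin n, l ∉ ({i, j} : Finset (Fin n)) := by
        by_contra h
        push Not at h
        have h1 : (Finset.univ : Finset (Fin n)) ⊆ {i, j} := fun x _ => h x
        have h2 := Finset.card_le_card h1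
        have h3 := Finset.card_le_two (a := i) (b := j)
        rw [Finset.card_univ, Fintype.card_fin] at h2
        omega
      simp only [Finset.mem_insert, Finset.mem_singleton, not_or] at hl
      have kY := key 1 j hj (by simp)
      have kZ := key 1 l (Ne.symm hl.1) (by simp)
      have kYZ := key (tv j l (Ne.symm hl.2)) l (Ne.symm hl.1) (tv_ne _ _ _ _ (Ne.symm hl.1))
      simp only [MulAut.one_apply] at kY kZ
      rw [tv_self, map_mul, (mul_entries _ _).1, kY.1] at kYZ
      have dY := det_eq (φ (FreeGroup.of j))
      have dZ := det_eq (φ (FreeGroup.of l))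
      rw [kY.1] at dY
      rw [kZ.1] at dZ
      have := kYZ.1
      simp only [zero_mul, zero_add, mul_eq_zero] at this
      rcases this with h | h
      · simp [h] at dY
      · simp [h] at dZ
  · -- parabolic
    exfalso
    have hd' := hd.resolve_left hb
    rw [← hd'] at hdet
    obtain ⟨j, hj⟩ := not_all_upper hI
    have hij : i ≠ j := by
      rintro rfl
      exact hj hu
    have h0 : mx X 0 0 * mx X 0 1 * mx (φ (FreeGroup.of j)) 1 0 = 0 := by
      apply fin_lin (mx X 0 0) (tr (φ (FreeGroup.of j))) _ hdet
      have := hH 1 i j hij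
      convert this using 3 with k
      simp only [MulAut.one_apply]
      rw [tr_eq, tr_eq, (mul_entries _ _).1, (mul_entries _ _).2.2.2]
      obtain ⟨a, b, c, -, d⟩ := upper_pow X hu k
      rw [← hX, a, b, c, d hd', ← hd']
      ring
    have ha0 : mx X 0 0 ≠ 0 := by intro h; simp [h] at hdet
    simp [ha0, hb, hj] at h0

theorem PF_of (hn : 3 ≤ n) {φ : FreeGroup (Fin n) →* SL2C} (hH : HH φ) (hI : Irr φ) : PF φ := by
  intro α i
  obtain ⟨P, h1, h2⟩ := normal_form (φ (α (FreeGroup.of i)))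
  have := PF_aux hn (cj_HH P α hH) (cj_Irr P α hI) i
  rw [cj_apply] at this
  exact (iof_conj P _).1 (this h1 h2)
end


theorem finord_normal (X : SL2C) (h : IsOfFinOrder X) : ∃ P : SL2C, mx (P⁻¹ * X * P) 1 0 = 0 ∧
    mx (P⁻¹ * X * P) 0 1 = 0 ∧ (∃ m : ℕ, 0 < m ∧ mx (P⁻¹ * X * P) 0 0 ^ m = 1) ∧
    ‖mx (P⁻¹ * X * P) 0 0‖ = 1 ∧
    mx (P⁻¹ * X * P) 1 1 = (starRingEnd ℂ) (mx (P⁻¹ * X * P) 0 0) := by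
  obtain ⟨P, h1, h2⟩ := normal_form X
  have hf := (iof_conj P X).2 h
  refine ⟨P, h1, ?_⟩
  set Y := P⁻¹ * X * P with hY
  obtain ⟨m, hm, hp⟩ := isOfFinOrder_iff_pow_eq_one.1 hf
  obtain ⟨a, b, c, d, e⟩ := upper_pow Y h1 m
  rw [hp, mx_one] at b e
  have hb : mx Y 0 0 ^ m = 1 := by simpa using b.symm
  have hdet := det_eq Y
  rw [h1, mul_zero, sub_zero] at hdet
  have hn : ‖mx Y 0 0‖ = 1 := Complex.norm_eq_one_of_pow_eq_one hb hm.ne'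
  have ha0 : mx Y 0 0 ≠ 0 := by intro h; simp [h] at hn
  refine ⟨?_, ⟨m, hm, hb⟩, hn, ?_⟩
  · rcases h2 with h2 | h2
    · exact h2
    · have := e h2
      rw [hb] at this
      simpa [ha0, hm.ne'] using this
  · rw [← Complex.inv_eq_conj hn]
    exact eq_inv_of_mul_eq_one_right hdet

theorem finord_tr (X : SL2C) (h : IsOfFinOrder X) : (tr X).im = 0 ∧ |(tr X).re| ≤ 2 ∧
    IsIntegral ℤ (tr X) := by
  obtain ⟨P, h1, h2, ⟨m, hm, hp⟩, hn, hc⟩ := finord_normal X h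
  rw [← tr_conj P X, tr_eq, hc]
  set a := mx (P⁻¹ * X * P) 0 0
  have ha : IsIntegral ℤ a := IsIntegral.of_pow hm (by rw [hp]; exact isIntegral_one)
  refine ⟨by simp, ?_, ha.add ?_⟩
  · have := Complex.abs_re_le_norm a
    rw [hn] at this
    simp only [Complex.add_re, Complex.conj_re]
    rw [abs_le] at *
    constructor <;> linarith
  · refine IsIntegral.of_pow hm ?_
    rw [← map_pow, hp]; simp [isIntegral_one]

section
variable {n : ℕ}

/-- normalised pair -/
def GP (φ : FreeGroup (Fin n) →* SL2C) (i j : Fin n) : Prop :=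
  i ≠ j ∧ mx (φ (FreeGroup.of i)) 1 0 = 0 ∧ mx (φ (FreeGroup.of i)) 0 1 = 0 ∧
  ‖mx (φ (FreeGroup.of i)) 0 0‖ = 1 ∧
  mx (φ (FreeGroup.of i)) 1 1 = (starRingEnd ℂ) (mx (φ (FreeGroup.of i)) 0 0) ∧
  (mx (φ (FreeGroup.of i)) 0 0).im ≠ 0 ∧ mx (φ (FreeGroup.of j)) 0 1 ≠ 0 ∧
  mx (φ (FreeGroup.of j)) 1 0 ≠ 0

theorem cj_cj (P Q : SL2C) (α β : MulAut (FreeGroup (Fin n))) (φ : FreeGroup (Fin n) →* SL2C) :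
    cj Q β (cj P α φ) = cj (P * Q) (α * β) φ := by
  ext g : 1
  simp only [cj_apply, MulAut.mul_apply]
  group

theorem exists_GP {φ : FreeGroup (Fin n) →* SL2C} (hP : PF φ) (hI : Irr φ) :
    ∃ P α i j, GP (cj P α φ) i j := by
  -- a nonscalar generator in diagonal form
  obtain ⟨i, P, h1, h2, h3, h4, h5⟩ : ∃ (i : Fin n) (P : SL2C),
      mx (cj P 1 φ (FreeGroup.of i)) 1 0 = 0 ∧ mx (cj P 1 φ (FreeGroup.of i)) 0 1 = 0 ∧
      ‖mx (cj P 1 φ (FreeGroup.of i)) 0 0‖ = 1 ∧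
      mx (cj P 1 φ (FreeGroup.of i)) 1 1 = (starRingEnd ℂ) (mx (cj P 1 φ (FreeGroup.of i)) 0 0) ∧
      (mx (cj P 1 φ (FreeGroup.of i)) 0 0).im ≠ 0 := by
    obtain ⟨i, hi⟩ := not_all_upper hI
    obtain ⟨P, h1, h2, -, h4, h5⟩ := finord_normal _ (hP 1 i)
    refine ⟨i, P, ?_⟩
    rw [cj_apply]
    refine ⟨h1, h2, h4, h5, ?_⟩
    intro him
    apply hi
    simp only [MulAut.one_apply] at *
    set X := φ (FreeGroup.of i)
    set Y := P⁻¹ * X * P with hY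
    have hc : mx Y 1 1 = mx Y 0 0 := by
      rw [h5]; exact Complex.conj_eq_iff_im.2 him
    have hs : mx Y = mx Y 0 0 • (1 : Matrix (Fin 2) (Fin 2) ℂ) := by
      ext k l
      fin_cases k <;> fin_cases l <;> simp [h1, h2, hc]
    have hX : X = P * Y * P⁻¹ := by rw [hY]; group
    have : mx X = mx Y 0 0 • (1 : Matrix (Fin 2) (Fin 2) ℂ) := by
      rw [hX, mx_mul, mx_mul, hs, mul_smul_comm, smul_mul_assoc, mul_one, ← mx_mul]
      simp [mx_one]
    rw [this]
    simp
  set ψ := cj P 1 φ with hψ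
  have hψI : Irr ψ := cj_Irr _ _ hI
  obtain ⟨j, hj⟩ := not_all_upper hψI
  obtain ⟨l, hl⟩ := not_all_lower hψI
  have hij : i ≠ j := by rintro rfl; exact hj h1
  have hil : i ≠ l := by rintro rfl; exact hl h2
  by_cases hj2 : mx (ψ (FreeGroup.of j)) 0 1 = 0
  · by_cases hl2 : mx (ψ (FreeGroup.of l)) 1 0 = 0
    · have hjl : j ≠ l := by rintro rfl; exact hl hj2
      refine ⟨P * 1, 1 * tv j l hjl, i, l, ?_⟩
      rw [← cj_cj, ← hψ]
      have e1 : cj 1 (tv j l hjl) ψ (FreeGroup.of i) = ψ (FreeGroup.of i) := by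
        rw [cj_apply, tv_ne _ _ _ _ hil]; simp
      have e2 : cj 1 (tv j l hjl) ψ (FreeGroup.of l) = ψ (FreeGroup.of j) * ψ (FreeGroup.of l) := by
        rw [cj_apply, tv_self]; simp
      have dj := det_eq (ψ (FreeGroup.of j))
      have dl := det_eq (ψ (FreeGroup.of l))
      rw [hj2, zero_mul, sub_zero] at dj
      rw [hl2, mul_zero, sub_zero] at dl
      unfold GP
      rw [e1, e2, (mul_entries _ _).2.1, (mul_entries _ _).2.2.1, hj2, hl2]
      refine ⟨hil, h1, h2, h3, h4, h5, ?_, ?_⟩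
      · have : mx (ψ (FreeGroup.of j)) 0 0 ≠ 0 := by intro h; simp [h] at dj
        simp [hl, this]
      · have : mx (ψ (FreeGroup.of l)) 0 0 ≠ 0 := by intro h; simp [h] at dl
        simp [hj, this]
    · exact ⟨P, 1, i, l, hil, h1, h2, h3, h4, h5, hl, hl2⟩
  · exact ⟨P, 1, i, j, hij, h1, h2, h3, h4, h5, hj2, hj⟩

theorem tr_real {φ : FreeGroup (Fin n) →* SL2C} (hP : PF φ) (g) : (tr (φ g)).im = 0 := by
  have e : φ = rho n (fun i => φ (FreeGroup.of i)) := by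
    ext i : 1
    simp [rho]
  have key := horowitz_mem g (fun i => φ (FreeGroup.of i)) (Complex.ofRealHom.range) (by
    intro I
    rw [← e]
    rcases I.eq_empty_or_nonempty with h | h
    · subst h
      refine ⟨2, ?_⟩
      simp [wI, tr_eq, mx_one]; norm_num
    · obtain ⟨α, i, hα⟩ := prim_wI I h
      rw [← hα]
      refine ⟨(tr (φ (α (FreeGroup.of i)))).re, ?_⟩
      apply Complex.ext <;> simp [(finord_tr _ (hP α i)).1])
  rw [← e] at key
  obtain ⟨x, hx⟩ := key
  rw [← hx]; simp
end


theorem tr_inv (X : SL2C) : tr X⁻¹ = tr X := by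
  rw [tr_eq, (inv_entries X).1, (inv_entries X).2.2.2, tr_eq]; ring

theorem tr_inv_mul (X Y : SL2C) : tr (X⁻¹ * Y) = tr X * tr Y - tr (X * Y) := by
  simp only [tr_eq, mul_entries X Y, mul_entries X⁻¹ Y, inv_entries]
  ring

theorem tr_sq_mul (X Y : SL2C) : tr (X * (X * Y)) = tr X * tr (X * Y) - tr Y := by
  have h := tr_inv_mul X (X * Y)
  rw [inv_mul_cancel_left] at h
  rw [h]; ring

section
variable {n : ℕ}

/-- set of trace triples of primitive pairs -/
def TS (φ : FreeGroup (Fin n) →* SL2C) : Set (ℝ × ℝ × ℝ) :=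
  {p | ∃ (α : MulAut (FreeGroup (Fin n))) (i j : Fin n), i ≠ j ∧
    p = ((tr (φ (α (FreeGroup.of i)))).re, (tr (φ (α (FreeGroup.of j)))).re,
      (tr (φ (α (FreeGroup.of i)) * φ (α (FreeGroup.of j)))).re)}

theorem TS_kap {φ : FreeGroup (Fin n) →* SL2C} (hP : PF φ) : ∀ p ∈ TS φ, kap p ≤ 2 := by
  have re_mul : ∀ g h, (tr (φ g) * tr (φ h)).re = (tr (φ g)).re * (tr (φ h)).re := by
    intro g h
    rw [Complex.mul_re, tr_real hP g]; simp
  apply no_big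
  · rintro _ ⟨α, i, j, hij, rfl⟩
    refine ⟨(finord_tr _ (hP α i)).2.1, (finord_tr _ (hP α j)).2.1, ?_⟩
    have := (finord_tr _ (hP (α * tv i j hij) j)).2.1
    rw [MulAut.mul_apply, tv_self, map_mul, map_mul] at this
    exact this
  · rintro _ ⟨α, i, j, hij, rfl⟩
    refine ⟨α * (tv j i hij.symm ^ 2 * iv j), i, j, hij, ?_⟩
    have e1 : (tv j i hij.symm ^ 2 * iv j) (FreeGroup.of i) =
        FreeGroup.of j * (FreeGroup.of j * FreeGroup.of i) := by
      rw [MulAut.mul_apply, iv_ne _ _ hij, tv_pow, pow_two, mul_assoc]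
    have e2 : (tv j i hij.symm ^ 2 * iv j) (FreeGroup.of j) = (FreeGroup.of j)⁻¹ := by
      rw [MulAut.mul_apply, iv_self, map_inv, pow_two, MulAut.mul_apply, tv_ne _ _ _ _ hij.symm,
        tv_ne _ _ _ _ hij.symm]
    rw [MulAut.mul_apply (e₁ := α), MulAut.mul_apply (e₁ := α), e1, e2]
    simp only [map_mul, map_inv]
    rw [tr_inv, tr_mul_comm _ (_)⁻¹, inv_mul_cancel_left, tr_sq_mul,
      tr_mul_comm (φ (α (FreeGroup.of j))), Complex.sub_re]
    have := re_mul (α (FreeGroup.of j)) (α (FreeGroup.of i) * α (FreeGroup.of j))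
    rw [map_mul] at this
    rw [this]
  · rintro _ ⟨α, i, j, hij, rfl⟩
    refine ⟨α * (tv i j hij ^ 2 * iv i), i, j, hij, ?_⟩
    have e1 : (tv i j hij ^ 2 * iv i) (FreeGroup.of j) =
        FreeGroup.of i * (FreeGroup.of i * FreeGroup.of j) := by
      rw [MulAut.mul_apply, iv_ne _ _ hij.symm, tv_pow, pow_two, mul_assoc]
    have e2 : (tv i j hij ^ 2 * iv i) (FreeGroup.of i) = (FreeGroup.of i)⁻¹ := by
      rw [MulAut.mul_apply, iv_self, map_inv, pow_two, MulAut.mul_apply, tv_ne _ _ _ _ hij,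
        tv_ne _ _ _ _ hij]
    rw [MulAut.mul_apply (e₁ := α), MulAut.mul_apply (e₁ := α), e1, e2]
    simp only [map_mul, map_inv]
    rw [tr_inv, inv_mul_cancel_left, tr_sq_mul, Complex.sub_re]
    have := re_mul (α (FreeGroup.of i)) (α (FreeGroup.of i) * α (FreeGroup.of j))
    rw [map_mul] at this
    rw [this]
  · rintro _ ⟨α, i, j, hij, rfl⟩
    refine ⟨α * iv i, i, j, hij, ?_⟩
    rw [MulAut.mul_apply, MulAut.mul_apply, iv_self, iv_ne _ _ hij.symm]
    simp only [map_inv]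
    rw [tr_inv, tr_inv_mul, Complex.sub_re, re_mul]

theorem real_lemma (a p s : ℂ) (hb : a.im ≠ 0) (h1 : (p + s).im = 0)
    (h2 : (a * p + (starRingEnd ℂ) a * s).im = 0) : s = (starRingEnd ℂ) p := by
  simp only [Complex.add_im, Complex.mul_im, Complex.conj_re, Complex.conj_im] at h1 h2
  have hs : s.im = - p.im := by linarith
  rw [hs] at h2
  have : a.im * (p.re - s.re) = 0 := by linarith
  have h3 := (mul_eq_zero.1 this).resolve_left hb
  apply Complex.ext
  · simp; linarith
  · simp [hs]

theorem U_bound {φ : FreeGroup (Fin n) →* SL2C} (hP : PF φ) {i j : Fin n} (hG : GP φ i j) (g) :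
    ‖tr (φ g)‖ ≤ 2 := by
  obtain ⟨hij, h10, h01, hn, hc, him, hq, hr⟩ := hG
  have hk := TS_kap hP _ ⟨1, i, j, hij, rfl⟩
  have r1 := tr_real hP (FreeGroup.of j)
  have r2 := tr_real hP (FreeGroup.of i * FreeGroup.of j)
  have r3 := tr_real hP g
  have r4 := tr_real hP (FreeGroup.of i * g)
  have r5 := tr_real hP (FreeGroup.of j * g)
  have r6 := tr_real hP (FreeGroup.of i * (FreeGroup.of j * g))
  simp only [MulAut.one_apply, map_mul] at hk r2 r4 r5 r6
  set X := φ (FreeGroup.of i)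
  set Y := φ (FreeGroup.of j)
  set Z := φ g
  have dY := det_eq Y
  have dZ := det_eq Z
  simp only [kap, tr_eq, mul_entries X, mul_entries Y Z] at hk r1 r2 r3 r4 r5 r6 ⊢
  rw [h10, h01, hc] at r2 r4 r6 hk
  simp only [zero_mul, add_zero, zero_add] at r2 r4 r6 hk
  have s1 := real_lemma _ _ _ him r1 r2
  have s2 := real_lemma _ _ _ him r3 r4
  have s3 := real_lemma _ _ _ him r5 r6
  generalize mx X 0 0 = a at *
  generalize mx Y 0 0 = p at *
  generalize mx Y 0 1 = q at *
  generalize mx Y 1 0 = r at *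
  generalize mx Y 1 1 = s at *
  generalize mx Z 0 0 = e at *
  generalize mx Z 0 1 = f at *
  generalize mx Z 1 0 = k at *
  generalize mx Z 1 1 = h at *
  subst s1 s2
  have hn2 : a.re ^ 2 + a.im ^ 2 = 1 := by
    have := Complex.sq_norm a
    rw [hn, Complex.normSq_apply] at this
    linarith
  -- q r is real and negative
  have hqr : q * r = ((p.re ^ 2 + p.im ^ 2 - 1 : ℝ) : ℂ) := by
    have : p * (starRingEnd ℂ) p = ((p.re ^ 2 + p.im ^ 2 : ℝ) : ℂ) := by
      rw [Complex.mul_conj, Complex.normSq_apply]; push_cast; ring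
    push_cast at this ⊢
    linear_combination this - dY
  have hfk : f * k = ((e.re ^ 2 + e.im ^ 2 - 1 : ℝ) : ℂ) := by
    have : e * (starRingEnd ℂ) e = ((e.re ^ 2 + e.im ^ 2 : ℝ) : ℂ) := by
      rw [Complex.mul_conj, Complex.normSq_apply]; push_cast; ring
    push_cast at this ⊢
    linear_combination this - dZ
  have hrf : r * f = (starRingEnd ℂ) (q * k) := by
    simp only [map_add, map_mul, Complex.conj_conj] at s3 ⊢
    linear_combination s3
  have hprod : (p.re ^ 2 + p.im ^ 2 - 1) * (e.re ^ 2 + e.im ^ 2 - 1) = Complex.normSq (q * k) := by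
    have : ((((p.re ^ 2 + p.im ^ 2 - 1) * (e.re ^ 2 + e.im ^ 2 - 1) : ℝ)) : ℂ) =
        ((Complex.normSq (q * k) : ℝ) : ℂ) := by
      rw [← Complex.mul_conj, ← hrf, Complex.ofReal_mul, ← hqr, ← hfk]; ring
    exact_mod_cast this
  have hneg : p.re ^ 2 + p.im ^ 2 - 1 < 0 := by
    have hne : p.re ^ 2 + p.im ^ 2 - 1 ≠ 0 := by
      intro h0
      rw [h0] at hqr
      simp [hq, hr] at hqr
    refine lt_of_le_of_ne ?_ hne
    simp at hk
    have : a.im ^ 2 * (p.re ^ 2 + p.im ^ 2 - 1) ≤ 0 := by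
      have e1 : a.re ^ 2 = 1 - a.im ^ 2 := by linarith
      nlinarith [hk, e1]
    have h2 : 0 < a.im ^ 2 := by positivity
    nlinarith
  have hle : e.re ^ 2 + e.im ^ 2 - 1 ≤ 0 := by
    have := Complex.normSq_nonneg (q * k)
    nlinarith
  have : ‖e + (starRingEnd ℂ) e‖ ≤ ‖e‖ + ‖(starRingEnd ℂ) e‖ := norm_add_le _ _
  rw [Complex.norm_conj] at this
  have h1 : ‖e‖ ≤ 1 := by
    have h3 := Complex.sq_norm e
    rw [Complex.normSq_apply] at h3
    nlinarith [norm_nonneg e]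
  linarith

theorem range_finite_of_tr {φ : FreeGroup (Fin n) →* SL2C} {i j : Fin n} (hG : GP φ i j)
    (hf : (Set.range fun g => tr (φ g)).Finite) : (Set.range φ).Finite := by
  obtain ⟨hij, h10, h01, hn, hc, him, hq, hr⟩ := hG
  refine finite_range_of_dep (fun g => (tr (φ g), tr (φ (FreeGroup.of i * g)),
    tr (φ (FreeGroup.of j * g)), tr (φ (FreeGroup.of i * (FreeGroup.of j * g))))) _ ?_ ?_
  · refine (hf.prod (hf.prod (hf.prod hf))).subset ?_
    rintro _ ⟨g, rfl⟩
    exact ⟨⟨_, rfl⟩, ⟨_, rfl⟩, ⟨_, rfl⟩, ⟨_, rfl⟩⟩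
  · intro g g' h
    simp only [Prod.mk.injEq, map_mul, tr_eq, mul_entries] at h
    obtain ⟨t1, t2, t3, t4⟩ := h
    rw [h10, h01] at t2 t4
    simp only [zero_mul, add_zero, zero_add] at t2 t4
    have hne : mx (φ (FreeGroup.of i)) 0 0 - mx (φ (FreeGroup.of i)) 1 1 ≠ 0 := by
      rw [hc]
      intro h
      have := congrArg Complex.im h
      simp at this
      exact him this
    have e00 : mx (φ g) 0 0 = mx (φ g') 0 0 := by
      apply mul_left_cancel₀ hne
      linear_combination t2 - mx (φ (FreeGroup.of i)) 1 1 * t1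
    have e11 : mx (φ g) 1 1 = mx (φ g') 1 1 := by linear_combination t1 - e00
    have e10 : mx (φ g) 1 0 = mx (φ g') 1 0 := by
      apply mul_left_cancel₀ hq
      apply mul_left_cancel₀ hne
      rw [e00, e11] at t3 t4
      linear_combination t4 - mx (φ (FreeGroup.of i)) 1 1 * t3
    have e01 : mx (φ g) 0 1 = mx (φ g') 0 1 := by
      apply mul_left_cancel₀ hr
      rw [e00, e11, e10] at t3
      linear_combination t3
    apply mx_inj
    ext k l
    fin_cases k <;> fin_cases l <;> simp [e00, e11, e10, e01]
end

section
variable {n : ℕ}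

theorem chi_fin (A : Fin n → SL2C) (h : (Set.range fun g => tr (rho n A g)).Finite) :
    (Set.range fun α : MulAut (FreeGroup (Fin n)) => chi n A α).Finite := by
  refine (Set.Finite.pi (t := fun _ : {I : Finset (Fin n) // I.Nonempty} =>
    (fun x => x / 2) '' (Set.range fun g => tr (rho n A g))) (fun _ => h.image _)).subset ?_
  rintro _ ⟨α, rfl⟩ I -
  exact ⟨_, ⟨α (wI n I.1), rfl⟩, rfl⟩

theorem irr_case (hn : 3 ≤ n) (A : Fin n → SL2C) (hper : ElemPeriodic n A)
    (hI : Irr (rho n A)) : (Set.range fun g => tr (rho n A g)).Finite ∧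
      ((Subgroup.closure (Set.range A) : Subgroup SL2C) : Set SL2C).Finite := by
  have hP := PF_of hn (HH_of_per A hper) hI
  have hb : ∀ (σ : ℂ ≃+* ℂ) g, ‖σ (tr (rho n A g))‖ ≤ 2 := by
    intro σ g
    obtain ⟨P, α, i, j, hG⟩ := exists_GP (map_PF σ hP) (map_Irr σ hI)
    have := U_bound (cj_PF P α (map_PF σ hP)) hG (α⁻¹ g)
    rw [cj_tr, MulAut.apply_inv_self, MonoidHom.comp_apply, map_tr] at this
    exact this
  have hfin : (Set.range fun g => tr (rho n A g)).Finite := by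
    refine fin_of_conj (Set.range fun I => tr (rho n A (wI n I))) (Set.finite_range _) ?_ _ ?_ ?_
    · rintro _ ⟨I, rfl⟩
      rcases I.eq_empty_or_nonempty with h | h
      · subst h
        have : tr (rho n A (wI n ∅)) = ((2 : ℤ) : ℂ) := by
          simp [wI, tr_eq, mx_one]; norm_num
        simp only [this]
        exact isIntegral_algebraMap (R := ℤ) (A := ℂ) (x := 2)
      · obtain ⟨α, i, hα⟩ := prim_wI I h
        simp only [← hα]
        exact (finord_tr _ (hP α i)).2.2
    · rintro _ ⟨g, rfl⟩
      exact horowitz_mem g A _ fun I => Subring.subset_closure ⟨I, rfl⟩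
    · rintro _ ⟨g, rfl⟩ σ
      exact hb σ g
  refine ⟨hfin, ?_⟩
  obtain ⟨P, α, i, j, hG⟩ := exists_GP hP hI
  have h1 := range_finite_of_tr hG (by
    refine hfin.subset ?_
    rintro _ ⟨g, rfl⟩
    exact ⟨α g, (cj_tr P α _ g).symm⟩)
  rw [← FreeGroup.range_lift_eq_closure]
  refine (h1.image (fun X => P * X * P⁻¹)).subset ?_
  rintro _ ⟨g, rfl⟩
  refine ⟨_, ⟨α⁻¹ g, rfl⟩, ?_⟩
  simp only [cj_apply, MulAut.apply_inv_self]
  rw [rho]; group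

theorem red_case (hn : 3 ≤ n) (A : Fin n → SL2C) (hper : ElemPeriodic n A)
    (hI : ¬ Irr (rho n A)) : (Set.range fun g => tr (rho n A g)).Finite ∧
      ∃ t : Fin n → ℝ, ∀ I : Finset (Fin n), 
        tr (rho n A (wI n I)) / 2 = (Real.cos (2 * π * ∑ i ∈ I, t i) : ℂ) := by
  unfold Irr at hI
  push Not at hI
  obtain ⟨v, hv, hl⟩ := hI
  choose l hl using hl
  have uniq : ∀ c d : ℂ, c • v = d • v → c = d := fun c d h => smul_left_injective ℂ hv h
  have lone : l 1 = 1 := by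
    apply uniq; rw [← hl]; simp [mx_one]
  have lmul : ∀ g h, l (g * h) = l g * l h := by
    intro g h
    apply uniq
    rw [← hl, map_mul, mx_mul, ← mulVec_mulVec, hl h, mulVec_smul, hl g, smul_smul, mul_comm]
  have lne : ∀ g, l g ≠ 0 := by
    intro g h
    have := lmul g g⁻¹
    rw [mul_inv_cancel, lone, h] at this
    simp at this
  have ltr : ∀ g, tr (rho n A g) = l g + (l g)⁻¹ := by
    intro g
    have h1 := congrArg (fun M => M *ᵥ v) (mx_sq (rho n A g))
    simp only [← mulVec_mulVec, hl, mulVec_smul, sub_mulVec, smul_mulVec, one_mulVec, smul_smul]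
      at h1
    have h2 : l g * l g = tr (rho n A g) * l g - 1 := by
      apply uniq
      rw [h1, sub_smul, one_smul]
    field_simp [lne g]
    linear_combination -h2
  let L : FreeGroup (Fin n) →* ℂ := ⟨⟨l, lone⟩, lmul⟩
  have lL : ∀ g, L g = l g := fun g => rfl
  have hroot : ∀ i, ∃ m : ℕ, 0 < m ∧ l (FreeGroup.of i) ^ m = 1 := by
    intro i
    by_contra hr
    push Not at hr
    obtain ⟨j, hj⟩ : ∃ j : Fin n, i ≠ j := by
      have : Nontrivial (Fin n) := Fin.nontrivial_iff_two_le.2 (by omega)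
      obtain ⟨j, hj⟩ := exists_ne i
      exact ⟨j, hj.symm⟩
    have hH := HH_of_per A hper 1 i j hj
    have := fin_exp (l (FreeGroup.of i)) (l (FreeGroup.of j)) (l (FreeGroup.of j))⁻¹ (lne _) hr (by
      convert hH using 3 with k
      simp only [MulAut.one_apply]
      rw [← map_pow, ← map_mul, ltr, ← lL (_ * _), map_mul, map_pow, lL, lL, mul_inv, inv_pow])
    exact lne _ this.1
  choose m hm hroot using hroot
  have hN : ∀ g, l g ^ (∏ i, m i) = 1 := by
    intro g
    have : (powMonoidHom (∏ i, m i)).comp L = 1 := by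
      ext i
      simp only [MonoidHom.comp_apply, powMonoidHom_apply, MonoidHom.one_apply, lL]
      obtain ⟨c, hc⟩ := Finset.dvd_prod_of_mem m (Finset.mem_univ i)
      rw [hc, pow_mul, hroot, one_pow]
    exact DFunLike.congr_fun this g
  have hNpos : 0 < ∏ i, m i := Finset.prod_pos fun i _ => hm i
  refine ⟨?_, ?_⟩
  · have hfin : {z : ℂ | z ^ (∏ i, m i) = 1}.Finite := by
      refine ((Polynomial.nthRoots (∏ i, m i) (1 : ℂ)).toFinset.finite_toSet).subset ?_
      intro z hz
      simp only [Finset.mem_coe, Multiset.mem_toFinset]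
      exact (Polynomial.mem_nthRoots hNpos).2 hz
    refine (hfin.image (fun z => z + z⁻¹)).subset ?_
    rintro _ ⟨g, rfl⟩
    exact ⟨l g, hN g, (ltr g).symm⟩
  · have ht : ∀ i, ∃ t : ℝ, l (FreeGroup.of i) = Complex.exp ((2 * π * t : ℝ) * Complex.I) := by
      intro i
      have hn := Complex.norm_eq_one_of_pow_eq_one (hroot i) (hm i).ne'
      refine ⟨(Complex.arg (l (FreeGroup.of i))) / (2 * π), ?_⟩
      have : 2 * π * (Complex.arg (l (FreeGroup.of i)) / (2 * π)) =
        Complex.arg (l (FreeGroup.of i)) := by field_simp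
      rw [this]
      have h2 := Complex.norm_mul_exp_arg_mul_I (l (FreeGroup.of i))
      rw [hn] at h2
      simpa using h2.symm
    choose t ht using ht
    refine ⟨t, fun I => ?_⟩
    have hw : l (wI n I) = Complex.exp ((2 * π * ∑ i ∈ I, t i : ℝ) * Complex.I) := by
      have h1 : L (wI n I) = ∏ i ∈ I, L (FreeGroup.of i) := by
        rw [wI, map_list_prod, List.map_map]
        conv_rhs => rw [← Finset.sort_toFinset I (· ≤ ·)]
        rw [List.prod_toFinset _ (I.sort_nodup (· ≤ ·))]
        rfl
      rw [← lL, h1, Finset.mul_sum, Complex.ofReal_sum, Finset.sum_mul, Complex.exp_sum]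
      exact Finset.prod_congr rfl fun i _ => ht i
    rw [ltr, hw, ← Complex.exp_neg, Complex.ofReal_cos, Complex.cos]
    congr 2
    ring_nf
end

theorem stmt19 (n : ℕ) (hn : 3 ≤ n) (A : Fin n → SL2C)
    (htr : ∀ I : Finset (Fin n), I.Nonempty →
      (Matrix.trace ((rho n A (wI n I) : Matrix (Fin 2) (Fin 2) ℂ))).im = 0)
    (hper : ElemPeriodic n A) :
    (Set.range fun α : MulAut (FreeGroup (Fin n)) => chi n A α).Finite ∧
    ( -- (i) all the traces come from a point of the n-torus
      (∃ t : Fin n → ℝ, ∀ I : Finset (Fin n), I.Nonempty →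
        Matrix.trace ((rho n A (wI n I) : Matrix (Fin 2) (Fin 2) ℂ)) / 2 =
          (Real.cos (2 * π * ∑ i ∈ I, t i) : ℂ))
      ∨
      -- (ii) ⟨A₁,…,A_n⟩ is finite
      ((Subgroup.closure (Set.range A) : Subgroup SL2C) : Set SL2C).Finite ) := by
  by_cases hI : Irr (rho n A)
  · obtain ⟨h1, h2⟩ := irr_case hn A hper hI
    exact ⟨chi_fin A h1, Or.inr h2⟩
  · obtain ⟨h1, t, ht⟩ := red_case hn A hper hI
    exact ⟨chi_fin A h1, Or.inl ⟨t, fun I _ => ht I⟩⟩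

end
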